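/- arXiv:1606.06155 — 2 statements merged into one kernel-verified Lean document; each statement's English description precedes it below -/
import Mathlib

section
/- Let k be a nonnegative integer and let s be a real number. Then for every x ∈ ℝ \ {0}, |x|^{2(k−s)} · ( (d/dx)^k [ |x|^s ] )² = ( k! · Σ_{n=⌈k/2⌉}^{k} 2^{2n−k} · C(s/2, n) · C(n, k−n) )². -/
/-- The falling factorial `(ν)_k = ν(ν−1)⋯(ν−k+1)`. -/
noncomputable def ffac (ν : ℝ) (k : ℕ) : ℝ := ∏ j ∈ Finset.range k, (ν - j)

/-- The generalized binomial coefficient `C(ν,k) = (ν)_k / k!`. -/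
noncomputable def gchoose (ν : ℝ) (k : ℕ) : ℝ := ffac ν k / (Nat.factorial k)

theorem ffac_succ (ν : ℝ) (k : ℕ) : ffac ν (k+1) = ffac ν k * (ν - k) := by
  simp [ffac, Finset.prod_range_succ]

/-- Coefficients of the k-th derivative expansion. -/
noncomputable def cc (n k : ℕ) : ℝ :=
  if n ≤ k ∧ k ≤ 2 * n then
    (k.factorial : ℝ) / (((2*n-k).factorial : ℝ) * ((k-n).factorial : ℝ)) * 2^(2*n-k) else 0

theorem cc_ij (i j : ℕ) : cc (i+j) (i+2*j) =
    ((i+2*j).factorial : ℝ) / ((i.factorial : ℝ) * (j.factorial : ℝ)) * 2^i := by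
  unfold cc
  rw [if_pos (by omega)]
  rw [show 2*(i+j)-(i+2*j) = i by omega, show i+2*j-(i+j) = j by omega]

theorem cc_zero (n k : ℕ) (h : ¬ (n ≤ k ∧ k ≤ 2 * n)) : cc n k = 0 := by
  unfold cc; rw [if_neg h]

theorem cc_rec (n k : ℕ) :
    cc (n+1) (k+1) = (2*((n:ℝ)+1)-k) * cc (n+1) k + 2 * cc n k := by
  by_cases h : n ≤ k ∧ k + 1 ≤ 2 * (n+1)
  · obtain ⟨j, rfl⟩ : ∃ j, k = n + j := ⟨k - n, by omega⟩
    obtain ⟨i, hi⟩ : ∃ i, n + 1 = i + j := ⟨n + 1 - j, by omega⟩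
    rcases i with _ | i
    · obtain rfl : j = n + 1 := by omega
      have e1 := cc_ij 0 (n+1)
      have e2 := cc_ij 1 n
      have e3 := cc_zero n (n + (n+1)) (by omega)
      rw [show 0 + (n+1) = n+1 by omega, show 0 + 2*(n+1) = n+(n+1)+1 by omega] at e1
      rw [show 1 + n = n+1 by omega, show 1 + 2*n = n+(n+1) by omega] at e2
      rw [e1, e2, e3, Nat.factorial_succ (n+(n+1)), Nat.factorial_succ n]
      push_cast
      have := Nat.factorial_ne_zero n
      simp
      field_simp
      ring
    · obtain rfl : n = i + j := by omega
      rcases j with _ | j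
      · have e1 := cc_ij (i+1) 0
        have e2 := cc_zero (i+0+1) (i + 0+0) (by omega)
        have e3 := cc_ij i 0
        simp only [mul_zero, add_zero] at *
        rw [e1, e2, e3, Nat.factorial_succ i]
        push_cast
        have := Nat.factorial_ne_zero i
        simp
        field_simp
        ring
      · have e1 := cc_ij (i+1) (j+1)
        have e2 := cc_ij (i+2) j
        have e3 := cc_ij i (j+1)
        rw [show i+1 + (j+1) = i+(j+1)+1 by omega, show i+1 + 2*(j+1) = i+(j+1)+(j+1)+1 by omega] at e1
        rw [show i+2 + j = i+(j+1)+1 by omega, show i+2 + 2*j = i+(j+1)+(j+1) by omega] at e2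
        rw [show i + 2*(j+1) = i+(j+1)+(j+1) by omega] at e3
        rw [e1, e2, e3, Nat.factorial_succ (i+(j+1)+(j+1)), Nat.factorial_succ j,
          Nat.factorial_succ (i+1), Nat.factorial_succ i]
        push_cast
        have := Nat.factorial_ne_zero i
        have := Nat.factorial_ne_zero j
        have : (i:ℝ)+1+1 ≠ 0 := by positivity
        field_simp
        ring
  · rw [cc_zero (n+1) (k+1) (by omega), cc_zero n k (by omega)]
    by_cases h2 : k = 2*(n+1)
    · subst h2; push_cast; ring
    · rw [cc_zero (n+1) k (by omega)]; ring

theorem cc_zero_rec (k : ℕ) : cc 0 (k+1) = -(k:ℝ) * cc 0 k := by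
  rw [cc_zero 0 (k+1) (by omega)]
  rcases k with _ | k
  · simp
  · rw [cc_zero 0 (k+1) (by omega)]; ring

theorem ffac_expand (ν : ℝ) (k : ℕ) :
    ffac (2*ν) k = ∑ n ∈ Finset.range (k+1), cc n k * ffac ν n := by
  induction k with
  | zero => simp [ffac, cc]
  | succ k ih =>
    rw [ffac_succ, ih, Finset.sum_range_succ' _ (k+1)]
    simp only [cc_rec, cc_zero_rec]
    have h1 : ∑ n ∈ Finset.range (k+1), (2*((n:ℝ)+1)-k) * cc (n+1) k * ffac ν (n+1)
        + -(k:ℝ) * cc 0 k * ffac ν 0 =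
        ∑ n ∈ Finset.range (k+1), (2*(n:ℝ)-k) * cc n k * ffac ν n := by
      have := Finset.sum_range_succ' (fun n => (2*(n:ℝ)-k) * cc n k * ffac ν n) (k+1)
      rw [Finset.sum_range_succ, cc_zero (k+1) k (by omega)] at this
      simp at this
      rw [this]; simp
    have h2 : ∑ n ∈ Finset.range (k+1), ((2*((n:ℝ)+1)-k) * cc (n+1) k + 2 * cc n k) * ffac ν (n+1)
       = ∑ n ∈ Finset.range (k+1), (2*((n:ℝ)+1)-k) * cc (n+1) k * ffac ν (n+1)
        + ∑ n ∈ Finset.range (k+1), 2 * cc n k * ffac ν (n+1) := by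
      rw [← Finset.sum_add_distrib]; apply Finset.sum_congr rfl; intros; ring
    rw [h2, add_right_comm, h1, ← Finset.sum_add_distrib, Finset.sum_mul]
    apply Finset.sum_congr rfl
    intro n _
    rw [ffac_succ]; ring

theorem ffac_nat (n j : ℕ) : ffac ((n+j:ℕ):ℝ) j * n.factorial = ((n+j).factorial : ℝ) := by
  induction j generalizing n with
  | zero => simp [ffac]
  | succ j ih =>
    have := ih (n+1)
    rw [show n + 1 + j = n + (j+1) by omega] at this
    rw [← this, ffac_succ, Nat.factorial_succ]; push_cast; ring

theorem sum_eq (k : ℕ) (s : ℝ) : (Nat.factorial k : ℝ) *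
        ∑ n ∈ Finset.Icc ((k + 1) / 2) k,
          (2 : ℝ) ^ (2 * n - k) * gchoose (s / 2) n * gchoose (n : ℝ) (k - n) = ffac s k := by
  have h := ffac_expand (s/2) k
  rw [mul_div_cancel₀ s (two_ne_zero)] at h
  rw [h, Finset.mul_sum]
  have hs : Finset.Icc ((k + 1) / 2) k ⊆ Finset.range (k+1) := by
    intro n; simp only [Finset.mem_Icc, Finset.mem_range]; omega
  rw [← Finset.sum_subset hs]
  · apply Finset.sum_congr rfl
    intro n hn
    simp only [Finset.mem_Icc] at hn
    obtain ⟨j, rfl⟩ : ∃ j, k = n + j := ⟨k - n, by omega⟩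
    obtain ⟨i, rfl⟩ : ∃ i, n = i + j := ⟨n - j, by omega⟩
    have e := cc_ij i j
    rw [show i + 2*j = i+j+j by omega] at e
    rw [e, show 2*(i+j)-(i+j+j) = i by omega, show i+j+j-(i+j) = j by omega]
    unfold gchoose
    have h1 := ffac_nat i j
    have hi : (i.factorial:ℝ) ≠ 0 := by positivity
    rw [← eq_div_iff hi] at h1
    rw [h1]
    have hj : (j.factorial:ℝ) ≠ 0 := by positivity
    have hij : ((i+j).factorial:ℝ) ≠ 0 := by positivity
    field_simp
  · intro n hn hn'
    simp only [Finset.mem_Icc, Finset.mem_range] at hn hn'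
    rw [cc_zero n k (by omega), zero_mul]

theorem ider_pos (k : ℕ) (s x : ℝ) (hx : 0 < x) :
    iteratedDeriv k (fun y : ℝ => |y| ^ s) x = ffac s k * x ^ (s - k) := by
  have : (fun y : ℝ => |y| ^ s) =ᶠ[nhds x] (fun y : ℝ => y ^ s) := by
    filter_upwards [lt_mem_nhds hx] with y hy
    rw [abs_of_pos hy]
  rw [this.iteratedDeriv_eq]
  induction k generalizing x with
  | zero => simp [ffac]
  | succ k ih =>
    rw [iteratedDeriv_succ]
    have h : iteratedDeriv k (fun y : ℝ => y ^ s) =ᶠ[nhds x] fun y => ffac s k * y ^ (s - k) := by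
      filter_upwards [lt_mem_nhds hx] with y hy
      apply ih y hy
      filter_upwards [lt_mem_nhds hy] with z hz
      rw [abs_of_pos hz]
    rw [h.deriv_eq]
    have := (Real.hasDerivAt_rpow_const (x := x) (p := s - k) (Or.inl hx.ne')).const_mul (ffac s k)
    rw [this.deriv, ffac_succ]
    push_cast
    rw [sub_sub]; ring

theorem stmt_10 (k : ℕ) (s : ℝ) (x : ℝ) (hx : x ≠ 0) :
    |x| ^ (2 * ((k : ℝ) - s)) * (iteratedDeriv k (fun y : ℝ => |y| ^ s) x) ^ 2 =
      ((Nat.factorial k : ℝ) *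
        ∑ n ∈ Finset.Icc ((k + 1) / 2) k,
          (2 : ℝ) ^ (2 * n - k) * gchoose (s / 2) n * gchoose (n : ℝ) (k - n)) ^ 2 := by
  rw [sum_eq]
  have key : (iteratedDeriv k (fun y : ℝ => |y| ^ s) x) ^ 2 = (ffac s k * |x| ^ (s - k)) ^ 2 := by
    rcases lt_or_gt_of_ne hx with h | h
    · have e := iteratedDeriv_comp_neg k (fun y : ℝ => |y| ^ s) x
      simp only [abs_neg] at e
      rw [e, ider_pos k s (-x) (by linarith), abs_of_neg h, smul_eq_mul, mul_pow, ← pow_mul,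
        mul_comm k 2, pow_mul]
      norm_num
    · rw [ider_pos k s x h, abs_of_pos h]
  have hp : 0 < |x| := abs_pos.mpr hx
  rw [key, mul_pow, ← Real.rpow_natCast (|x| ^ (s - k)) 2, ← Real.rpow_mul hp.le,
    mul_left_comm, ← Real.rpow_add hp]
  rw [show 2 * ((k:ℝ) - s) + (s - k) * ((2:ℕ):ℝ) = 0 by push_cast; ring, Real.rpow_zero, mul_one]
end

section
/- Let k be a positive integer. Then for every x ∈ ℝ \ {0}, |x|^{2k} · ( (d/dx)^k [ log|x| ] )² = ( k! · Σ_{n=⌈k/2⌉}^{k} 2^{2n−k} · ((−1)^n/(2n)) · C(n, k−n) )². -/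
theorem H_eq (k : ℕ) : ∑ p ∈ Finset.HasAntidiagonal.antidiagonal k, (-4 : ℝ) ^ p.1 * (p.1.choose p.2 : ℝ)
    = (-2) ^ k * (k + 1) := by
  induction k using Nat.twoStepInduction with
  | zero => simp
  | one => simp [Finset.Nat.antidiagonal_succ]; norm_num
  | more k h0 h1 =>
    rw [Finset.Nat.sum_antidiagonal_succ, Finset.Nat.sum_antidiagonal_succ']
    rw [Finset.Nat.sum_antidiagonal_succ'] at h1
    simp only [Nat.choose_succ_succ, Nat.choose_zero_succ, Nat.choose_zero_right, pow_succ,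
      Nat.cast_add, mul_add, Finset.sum_add_distrib] at h1 ⊢
    have e1 : ∀ f : ℕ × ℕ → ℝ, ∑ p ∈ Finset.HasAntidiagonal.antidiagonal k, (-4 : ℝ) ^ p.1 * (-4) * f p =
        (-4) * ∑ p ∈ Finset.HasAntidiagonal.antidiagonal k, (-4 : ℝ) ^ p.1 * f p := by
      intro f
      rw [Finset.mul_sum]
      exact Finset.sum_congr rfl fun p _ => by ring
    rw [e1 (fun p => (p.1.choose p.2 : ℝ)), e1 (fun p => (p.1.choose (p.2 + 1) : ℝ)), h0]
    push_cast at h1 ⊢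
    linear_combination (-4) * h1

theorem Q_eq (m : ℕ) : ∑ p ∈ Finset.HasAntidiagonal.antidiagonal m,
    (-4 : ℝ) ^ (p.1 + 1) * ((m + 1 : ℝ) / (p.1 + 1) * ((p.1 + 1).choose p.2 : ℝ))
    = 2 * (-2) ^ (m + 1) := by
  rcases m with _ | m
  · simp; norm_num
  have hH := H_eq (m + 2)
  rw [Finset.Nat.sum_antidiagonal_succ, Finset.Nat.sum_antidiagonal_succ'] at hH
  rw [Finset.Nat.sum_antidiagonal_succ']
  have key : ∀ p ∈ Finset.HasAntidiagonal.antidiagonal m, (-4 : ℝ) ^ (p.1 + 1) *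
      (((m + 1 : ℕ) + 1 : ℝ) / (p.1 + 1) * ((p.1 + 1).choose (p.2 + 1) : ℝ)) =
      (-4 : ℝ) ^ (p.1 + 1) * ((p.1 + 1).choose (p.2 + 1) : ℝ)
       + (-4) * ((-4 : ℝ) ^ p.1 * (p.1.choose p.2 : ℝ)) := by
    intro p hp
    have hp' : (p.1 : ℝ) + p.2 = m := by exact_mod_cast Finset.HasAntidiagonal.mem_antidiagonal.mp hp
    have hc : ((p.1 : ℝ) + 1) * (p.1.choose p.2 : ℝ) =
        ((p.1 + 1).choose (p.2 + 1) : ℝ) * (p.2 + 1) := by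
      exact_mod_cast Nat.add_one_mul_choose_eq p.1 p.2
    have h0 : (p.1 : ℝ) + 1 ≠ 0 := by positivity
    push_cast
    rw [← hp']
    field_simp
    linear_combination (-4) * (-4 : ℝ) ^ p.1 * (-hc)
  rw [Finset.sum_congr rfl key, Finset.sum_add_distrib, ← Finset.mul_sum, H_eq]
  have h0 : (m : ℝ) + 1 + 1 ≠ 0 := by positivity
  simp only [Nat.choose_zero_succ, Nat.choose_zero_right] at hH ⊢
  push_cast at hH ⊢
  rw [div_self h0]
  linear_combination hH

theorem gchoose_nat (n j : ℕ) : gchoose (n : ℝ) j = (n.choose j : ℝ) := by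
  unfold gchoose ffac
  rw [← descPochhammer_eval_eq_prod_range, descPochhammer_eval_eq_descFactorial,
    Nat.descFactorial_eq_factorial_mul_choose]
  have : (j.factorial : ℝ) ≠ 0 := by positivity
  push_cast
  field_simp

theorem S_eq (m : ℕ) : ((m : ℝ) + 1) * ∑ n ∈ Finset.Icc ((m + 1 + 1) / 2) (m + 1),
          (2 : ℝ) ^ (2 * n - (m + 1)) * ((-1 : ℝ) ^ n / (2 * n)) * gchoose (n : ℝ) (m + 1 - n)
     = (-1) ^ (m + 1) := by
  have hQ := Q_eq m
  rw [Finset.Nat.sum_antidiagonal_eq_sum_range_succ_mk] at hQ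
  have h1 : ∑ n ∈ Finset.Icc ((m + 1 + 1) / 2) (m + 1),
          (2 : ℝ) ^ (2 * n - (m + 1)) * ((-1 : ℝ) ^ n / (2 * n)) * gchoose (n : ℝ) (m + 1 - n)
      = ∑ n ∈ Finset.Icc 1 (m + 1),
          (-4 : ℝ) ^ n / 2 ^ (m + 1) / (2 * n) * (n.choose (m + 1 - n) : ℝ) := by
    rw [← Finset.sum_subset (s₁ := Finset.Icc ((m + 1 + 1) / 2) (m + 1))
      (s₂ := Finset.Icc 1 (m + 1))]
    · refine Finset.sum_congr rfl fun n hn => ?_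
      rw [Finset.mem_Icc] at hn
      rw [gchoose_nat, pow_sub₀ _ two_ne_zero (by omega), pow_mul,
        show (-4 : ℝ) = 2 ^ 2 * (-1) by norm_num, mul_pow]
      ring
    · intro n hn
      rw [Finset.mem_Icc] at *
      omega
    · intro n hn hn'
      rw [Finset.mem_Icc] at *
      rw [Nat.choose_eq_zero_of_lt (by omega)]
      simp
  rw [h1, Finset.range_eq_Ico] at *
  rw [← Finset.Ico_add_one_right_eq_Icc, Finset.sum_Ico_eq_sum_range]
  rw [← Finset.range_eq_Ico] at hQ
  have h2 : (2 : ℝ) ^ (m + 1) * 2 ≠ 0 := by positivity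
  have h3 : (2 : ℝ) * (-2) ^ (m + 1) = (2 ^ (m + 1) * 2) * (-1) ^ (m + 1) := by
    rw [show (-2 : ℝ) = 2 * (-1) by norm_num, mul_pow]; ring
  rw [h3] at hQ
  apply mul_left_cancel₀ h2
  rw [← hQ, Finset.mul_sum, Finset.mul_sum]
  refine Finset.sum_congr (by simp) fun n hn => ?_
  have h4 : (n : ℝ) + 1 ≠ 0 := by positivity
  rw [show m + 1 - (1 + n) = m - n by omega, add_comm 1 n]
  push_cast
  field_simp

theorem stmt_11 (k : ℕ) (hk : 0 < k) (x : ℝ) (hx : x ≠ 0) :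
    |x| ^ (2 * k) * (iteratedDeriv k (fun y : ℝ => Real.log |y|) x) ^ 2 =
      ((Nat.factorial k : ℝ) *
        ∑ n ∈ Finset.Icc ((k + 1) / 2) k,
          (2 : ℝ) ^ (2 * n - k) * ((-1 : ℝ) ^ n / (2 * n)) * gchoose (n : ℝ) (k - n)) ^ 2 := by
  obtain ⟨m, rfl⟩ : ∃ m, k = m + 1 := ⟨k - 1, by omega⟩
  have hS := S_eq m
  rw [Nat.factorial_succ]
  push_cast
  rw [mul_comm ((m : ℝ) + 1), mul_assoc, hS]
  simp only [Real.log_abs]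
  rw [iteratedDeriv_succ', Real.deriv_log', iteratedDeriv_eq_iterate, iter_deriv_inv, mul_pow, mul_pow, mul_pow,
    ← pow_mul, ← pow_mul, mul_comm m 2, mul_comm (m + 1) 2, pow_mul, sq_abs, ← pow_mul]
  have h : (x ^ (-1 - (m : ℤ))) = (x ^ (m + 1))⁻¹ := by
    rw [← zpow_natCast, ← zpow_neg]; congr 1; push_cast; ring
  rw [h, pow_mul (-1 : ℝ), pow_mul (-1 : ℝ)]
  have := pow_ne_zero (m + 1) hx
  simp only [even_two, Even.neg_pow, one_pow, one_mul, mul_one]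
  field_simp
  try ring
end
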